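/- For unit quaternions q₁, q₂ define the great circle C(q₁, q₂) := {q₁·(cos s + sin s·i)·q₂⁻¹ : s ∈ ℝ} ⊆ ℍ. Then for unit quaternions q₁, q₂, q₁′, q₂′ one has C(q₁, q₂) = C(q₁′, q₂′) as sets if and only if either (q₁′ i q₁′⁻¹, q₂′ i q₂′⁻¹) = (q₁ i q₁⁻¹, q₂ i q₂⁻¹) or (q₁′ i q₁′⁻¹, q₂′ i q₂′⁻¹) = (−q₁ i q₁⁻¹, −q₂ i q₂⁻¹). -/

import Mathlib

open scoped Quaternion

noncomputable section

/-- The quaternion `i`. -/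
def iq : ℍ[ℝ] := ⟨0, 1, 0, 0⟩

/-- The unit quaternion `e^{is} = cos s + sin s · i`. -/
def eI (s : ℝ) : ℍ[ℝ] := ⟨Real.cos s, Real.sin s, 0, 0⟩

/-- The great circle `C(q₁, q₂) = {q₁·(cos s + sin s·i)·q₂⁻¹ : s ∈ ℝ}`. -/
def greatCircle (q₁ q₂ : ℍ[ℝ]) : Set ℍ[ℝ] := {x | ∃ s : ℝ, x = q₁ * eI s * q₂⁻¹}

@[simp] theorem iq_re : iq.re = 0 := rfl
@[simp] theorem iq_imI : iq.imI = 1 := rfl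
@[simp] theorem iq_imJ : iq.imJ = 0 := rfl
@[simp] theorem iq_imK : iq.imK = 0 := rfl
@[simp] theorem eI_re (s : ℝ) : (eI s).re = Real.cos s := rfl
@[simp] theorem eI_imI (s : ℝ) : (eI s).imI = Real.sin s := rfl
@[simp] theorem eI_imJ (s : ℝ) : (eI s).imJ = 0 := rfl
@[simp] theorem eI_imK (s : ℝ) : (eI s).imK = 0 := rfl

theorem eI_add' (s t : ℝ) : eI s * eI t = eI (s + t) := by
  ext <;> simp [Real.cos_add, Real.sin_add, add_comm]

theorem exists_eI (x : ℍ[ℝ]) (hx : ‖x‖ = 1) (hc : x * iq = iq * x) : ∃ t, x = eI t := by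
  have hJ := congrArg (fun q : ℍ[ℝ] => q.imJ) hc
  have hK := congrArg (fun q : ℍ[ℝ] => q.imK) hc
  simp at hJ hK
  have h3 : x.imK = 0 := by linarith
  have h2 : x.imJ = 0 := by linarith
  have hn : x.re ^ 2 + x.imI ^ 2 = 1 := by
    have h := Quaternion.normSq_eq_norm_mul_self x
    rw [Quaternion.normSq_def', hx, h2, h3] at h
    linarith
  have hz : ‖(⟨x.re, x.imI⟩ : ℂ)‖ = 1 := by
    rw [Complex.norm_def, Complex.normSq_mk, Real.sqrt_eq_one]
    linarith
  have hz0 : (⟨x.re, x.imI⟩ : ℂ) ≠ 0 := by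
    intro h
    rw [h] at hz
    simp at hz
  refine ⟨Complex.arg ⟨x.re, x.imI⟩, ?_⟩
  ext
  · simp [Complex.cos_arg hz0, hz]
  · simp [Complex.sin_arg, hz]
  · simpa using h2
  · simpa using h3

theorem iq_eI (s : ℝ) : iq * eI s = eI s * iq := by
  ext <;> simp

theorem iq_sq : iq * iq = -1 := by
  ext <;> simp

theorem eI_zero' : eI 0 = 1 := by
  ext <;> simp

theorem eI_pi2 : eI (Real.pi / 2) = iq := by
  ext <;> simp

theorem eI_conj_pos (a : ℍ[ℝ]) (h : a * iq = iq * a) (s : ℝ) : a * eI s = eI s * a := by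
  have e : eI s = algebraMap ℝ ℍ[ℝ] (Real.cos s) + Real.sin s • iq := by
    ext <;> simp
  rw [e, mul_add, add_mul, mul_smul_comm, smul_mul_assoc, h, Algebra.commutes]

theorem eI_conj_neg (a : ℍ[ℝ]) (h : a * iq = -(iq * a)) (s : ℝ) :
    a * eI s = eI (-s) * a := by
  have e (s : ℝ) : eI s = algebraMap ℝ ℍ[ℝ] (Real.cos s) + Real.sin s • iq := by
    ext <;> simp
  rw [e, e, mul_add, add_mul, mul_smul_comm, smul_mul_assoc, h, Real.cos_neg, Real.sin_neg,
    Algebra.commutes, smul_neg, neg_smul]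

theorem ne_zero_of_norm_one {q : ℍ[ℝ]} (h : ‖q‖ = 1) : q ≠ 0 := by
  rintro rfl
  simp at h

theorem conj_move {q q' r : ℍ[ℝ]} (h : q ≠ 0) (h' : q' ≠ 0) :
    q' * iq * q'⁻¹ = q * r * q⁻¹ ↔ (q⁻¹ * q') * iq = r * (q⁻¹ * q') := by
  rw [mul_inv_eq_iff_eq_mul₀ h']
  constructor
  · intro e
    rw [mul_assoc, e]
    simp only [mul_assoc]
    rw [inv_mul_cancel_left₀ h]
  · intro e
    have := congrArg (q * ·) e
    simp only [mul_assoc] at this ⊢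
    rwa [mul_inv_cancel_left₀ h] at this

theorem circle_subset {q₁ q₂ q₁' q₂' : ℍ[ℝ]}
    (h₁ : ‖q₁‖ = 1) (h₂ : ‖q₂‖ = 1) (h₁' : ‖q₁'‖ = 1) (h₂' : ‖q₂'‖ = 1)
    (h : (q₁' * iq * q₁'⁻¹ = q₁ * iq * q₁⁻¹ ∧ q₂' * iq * q₂'⁻¹ = q₂ * iq * q₂⁻¹) ∨
        (q₁' * iq * q₁'⁻¹ = -(q₁ * iq * q₁⁻¹) ∧ q₂' * iq * q₂'⁻¹ = -(q₂ * iq * q₂⁻¹))) :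
    greatCircle q₁' q₂' ⊆ greatCircle q₁ q₂ := by
  have n₁ := ne_zero_of_norm_one h₁
  have n₂ := ne_zero_of_norm_one h₂
  have n₁' := ne_zero_of_norm_one h₁'
  have n₂' := ne_zero_of_norm_one h₂'
  have neg (q : ℍ[ℝ]) : -(q * iq * q⁻¹) = q * (-iq) * q⁻¹ := by simp
  rw [neg, neg, conj_move n₁ n₁', conj_move n₂ n₂', conj_move n₁ n₁', conj_move n₂ n₂'] at h
  obtain ⟨a, ha⟩ : ∃ a, a = q₁⁻¹ * q₁' := ⟨_, rfl⟩
  obtain ⟨b, hb⟩ : ∃ b, b = q₂⁻¹ * q₂' := ⟨_, rfl⟩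
  have b0 : b ≠ 0 := by rw [hb]; exact mul_ne_zero (inv_ne_zero n₂) n₂'
  rw [← ha, ← hb] at h
  have hn : ‖a * b⁻¹‖ = 1 := by simp [ha, hb, h₁, h₂, h₁', h₂']
  have hcomm : a * b⁻¹ * iq = iq * (a * b⁻¹) := by
    rcases h with ⟨ea, eb⟩ | ⟨ea, eb⟩
    · have : b⁻¹ * iq = iq * b⁻¹ := by
        rw [eq_mul_inv_iff_mul_eq₀ b0, mul_assoc, ← eb, inv_mul_cancel_left₀ b0]
      rw [mul_assoc, this, ← mul_assoc, ea, mul_assoc]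
    · have : b⁻¹ * iq = -iq * b⁻¹ := by
        rw [eq_mul_inv_iff_mul_eq₀ b0, mul_assoc]
        have : iq * b = -(b * iq) := by rw [eb]; simp
        rw [this, mul_neg, inv_mul_cancel_left₀ b0]
      rw [mul_assoc, this, ← mul_assoc, mul_neg, ea]
      simp [mul_assoc]
  obtain ⟨t, ht⟩ := exists_eI _ hn hcomm
  have key (s : ℝ) : ∃ s', a * eI s * b⁻¹ = eI s' := by
    rcases h with ⟨ea, eb⟩ | ⟨ea, eb⟩
    · exact ⟨s + t, by rw [eI_conj_pos a ea, mul_assoc, ht, eI_add']⟩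
    · exact ⟨-s + t, by rw [eI_conj_neg a (by rw [ea, neg_mul]), mul_assoc, ht, eI_add']⟩
  rintro x ⟨s, rfl⟩
  obtain ⟨s', hs⟩ := key s
  refine ⟨s', ?_⟩
  rw [← hs, ha, hb, mul_inv_rev, inv_inv]
  simp only [mul_assoc]
  rw [mul_inv_cancel_left₀ n₁, mul_inv_cancel₀ n₂, mul_one]

theorem forward {q₁ q₂ q₁' q₂' : ℍ[ℝ]}
    (h₁ : ‖q₁‖ = 1) (h₂ : ‖q₂‖ = 1) (h₁' : ‖q₁'‖ = 1) (h₂' : ‖q₂'‖ = 1)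
    (h : greatCircle q₁' q₂' ⊆ greatCircle q₁ q₂) :
    (q₁' * iq * q₁'⁻¹ = q₁ * iq * q₁⁻¹ ∧ q₂' * iq * q₂'⁻¹ = q₂ * iq * q₂⁻¹) ∨
        (q₁' * iq * q₁'⁻¹ = -(q₁ * iq * q₁⁻¹) ∧ q₂' * iq * q₂'⁻¹ = -(q₂ * iq * q₂⁻¹)) := by
  have n₁ := ne_zero_of_norm_one h₁
  have n₂ := ne_zero_of_norm_one h₂
  have n₁' := ne_zero_of_norm_one h₁'
  have n₂' := ne_zero_of_norm_one h₂'
  have neg (q : ℍ[ℝ]) : -(q * iq * q⁻¹) = q * (-iq) * q⁻¹ := by simp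
  rw [neg, neg, conj_move n₁ n₁', conj_move n₂ n₂', conj_move n₁ n₁', conj_move n₂ n₂']
  have key (s : ℝ) : ∃ u, (q₁⁻¹ * q₁') * eI s = eI u * (q₂⁻¹ * q₂') := by
    obtain ⟨u, hu⟩ := h ⟨s, rfl⟩
    refine ⟨u, ?_⟩
    rw [mul_inv_eq_iff_eq_mul₀ n₂'] at hu
    rw [mul_assoc, hu]
    simp only [mul_assoc]
    rw [inv_mul_cancel_left₀ n₁]
  obtain ⟨a, ha⟩ : ∃ a, a = q₁⁻¹ * q₁' := ⟨_, rfl⟩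
  obtain ⟨b, hb⟩ : ∃ b, b = q₂⁻¹ * q₂' := ⟨_, rfl⟩
  have a0 : a ≠ 0 := by rw [ha]; exact mul_ne_zero (inv_ne_zero n₁) n₁'
  rw [← ha, ← hb] at key ⊢
  obtain ⟨u, hu⟩ := key 0
  obtain ⟨v, hv⟩ := key (Real.pi / 2)
  rw [eI_zero', mul_one] at hu
  rw [eI_pi2] at hv
  have hb' : b = eI (-u) * a := by
    rw [hu, ← mul_assoc, eI_add', neg_add_cancel, eI_zero', one_mul]
  rw [hb', ← mul_assoc, eI_add'] at hv
  generalize v + -u = w at hv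
  have hw : eI w * eI w = -1 := by
    apply mul_right_cancel₀ a0
    rw [mul_assoc, ← hv, ← mul_assoc, ← hv, mul_assoc, iq_sq]
    simp
  have hw2 : (eI w - iq) * (eI w + iq) = 0 := by
    rw [sub_mul, mul_add, mul_add, hw, iq_sq, iq_eI]
    abel
  rcases mul_eq_zero.1 hw2 with e | e
  · left
    rw [sub_eq_zero.1 e] at hv
    refine ⟨hv, ?_⟩
    rw [hb', mul_assoc, hv, ← mul_assoc, ← mul_assoc, iq_eI]
  · right
    rw [eq_neg_of_add_eq_zero_left e] at hv
    refine ⟨hv, ?_⟩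
    rw [hb', mul_assoc, hv, ← mul_assoc, ← mul_assoc, neg_mul iq, iq_eI, mul_neg]

/-- Two parameterized great circles coincide as sets iff the corresponding pairs of
pure unit quaternions `(q₁ i q₁⁻¹, q₂ i q₂⁻¹)` agree up to simultaneous negation;
this is the parameterization of unoriented geodesics in `S³` by `(S² × S²)/±`. -/
theorem greatCircle_eq_iff (q₁ q₂ q₁' q₂' : ℍ[ℝ])
    (h₁ : ‖q₁‖ = 1) (h₂ : ‖q₂‖ = 1) (h₁' : ‖q₁'‖ = 1) (h₂' : ‖q₂'‖ = 1) :
    greatCircle q₁ q₂ = greatCircle q₁' q₂' ↔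
      (q₁' * iq * q₁'⁻¹ = q₁ * iq * q₁⁻¹ ∧ q₂' * iq * q₂'⁻¹ = q₂ * iq * q₂⁻¹) ∨
        (q₁' * iq * q₁'⁻¹ = -(q₁ * iq * q₁⁻¹) ∧ q₂' * iq * q₂'⁻¹ = -(q₂ * iq * q₂⁻¹)) := by
  constructor
  · intro h
    exact forward h₁ h₂ h₁' h₂' h.ge
  · intro h
    refine Set.Subset.antisymm (circle_subset h₁' h₂' h₁ h₂ ?_) (circle_subset h₁ h₂ h₁' h₂' h)
    rcases h with ⟨x, y⟩ | ⟨x, y⟩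
    · exact Or.inl ⟨x.symm, y.symm⟩
    · exact Or.inr ⟨by rw [x, neg_neg], by rw [y, neg_neg]⟩

end
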